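/- arXiv:math/0010112 — 3 statements merged into one kernel-verified Lean document; each statement's English description precedes it below -/
import Mathlib

section
/- Let U ⊆ ℝ^N be open, let Φ : U → ℂ be four times continuously differentiable, and let h ∈ M_N(ℂ) be an invertible symmetric matrix with inverse entries h^{ki}. Define matrix-valued functions Γ_ℓ : U → M_N(ℂ) by (Γ_ℓ)^i_j(t) = Σ_k (∂_ℓ ∂_j ∂_k Φ)(t) h^{ki}. Assume that for every t ∈ U the matrices pairwise commute: Γ_s(t) Γ_ℓ(t) = Γ_ℓ(t) Γ_s(t) for all s, ℓ. Then ∂_s Γ_ℓ = ∂_ℓ Γ_s on U for all s, ℓ, and consequently for every ℏ ∈ ℂ the connection form ℏ ω with ω = Σ_ℓ Γ_ℓ dt^ℓ has vanishing curvature: ℏ(∂_s Γ_ℓ − ∂_ℓ Γ_s) + ℏ²(Γ_s Γ_ℓ − Γ_ℓ Γ_s) = 0 for all s, ℓ. -/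
open Matrix

attribute [local instance] Matrix.normedAddCommGroup Matrix.normedSpace

section DirectionalDerivatives

variable {E F : Type*} [NormedAddCommGroup E] [NormedSpace ℝ E]
  [NormedAddCommGroup F] [NormedSpace ℝ F]

/-- Directional derivatives on an open set lose one degree of smoothness. -/
theorem ContDiffOn.fderiv_apply_const_of_isOpen {U : Set E} (hU : IsOpen U) {m n : WithTop ℕ∞}
    {f : E → F} (hf : ContDiffOn ℝ n f U) (hmn : m + 1 ≤ n) (v : E) :
    ContDiffOn ℝ m (fun t => fderiv ℝ f t v) U :=
  (hf.fderiv_of_isOpen hU hmn).clm_apply contDiffOn_const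

/-- Directional derivatives of a twice continuously differentiable map commute. -/
theorem ContDiffAt.fderiv_fderiv_apply_comm {f : E → F} {t : E} (hf : ContDiffAt ℝ 2 f t)
    (v w : E) :
    fderiv ℝ (fun x => fderiv ℝ f x v) t w = fderiv ℝ (fun x => fderiv ℝ f x w) t v := by
  have hd : DifferentiableAt ℝ (fderiv ℝ f) t :=
    (hf.fderiv_right (m := 1) (by norm_num)).differentiableAt one_ne_zero
  have key (u u' : E) :
      fderiv ℝ (fun x => fderiv ℝ f x u) t u' = fderiv ℝ (fderiv ℝ f) t u' u := by
    rw [fderiv_clm_apply hd (differentiableAt_const u)]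
    simp
  rw [key, key]
  exact (hf.isSymmSndFDerivAt (by simp)).eq w v

end DirectionalDerivatives

/-- The derivative of a matrix-valued map is computed entrywise. -/
theorem Matrix.fderiv_apply_apply {E m n : Type*} [NormedAddCommGroup E] [NormedSpace ℝ E]
    [Fintype m] [Fintype n] {A : E → Matrix m n ℂ} {t : E}
    (hA : ∀ i j, DifferentiableAt ℝ (fun x => A x i j) t) (v : E) (i : m) (j : n) :
    fderiv ℝ A t v i j = fderiv ℝ (fun x => A x i j) t v := by
  have hrow (i : m) : HasFDerivAt (fun x => A x i)
      (ContinuousLinearMap.pi fun j => fderiv ℝ (fun x => A x i j) t) t :=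
    hasFDerivAt_pi.2 fun j => (hA i j).hasFDerivAt
  have hmat : HasFDerivAt (F := m → n → ℂ) A (ContinuousLinearMap.pi fun i =>
      ContinuousLinearMap.pi fun j => fderiv ℝ (fun x => A x i j) t) t :=
    hasFDerivAt_pi.2 hrow
  exact congrArg (fun L : E →L[ℝ] m → n → ℂ => L v i j) hmat.fderiv

/-- **Flatness of the Dubrovin connection for a potential product.**
Let `U ⊆ ℝ^N` be open, `Φ : U → ℂ` be `C⁴`, and `h ∈ M_N(ℂ)` invertible and symmetric,
with inverse entries `h⁻¹ k i`.  Define `(Γ ℓ)^i_j (t) = Σ_k (∂_ℓ ∂_j ∂_k Φ)(t) · h⁻¹ k i`,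
and assume the matrices `Γ ℓ (t)` pairwise commute for every `t ∈ U`.
Then `∂_s Γ_ℓ = ∂_ℓ Γ_s` on `U`, and consequently for every `ℏ ∈ ℂ` the curvature of the
connection form `ℏ ω`, `ω = Σ_ℓ Γ_ℓ dt^ℓ`, vanishes:
`ℏ(∂_s Γ_ℓ − ∂_ℓ Γ_s) + ℏ²(Γ_s Γ_ℓ − Γ_ℓ Γ_s) = 0`. -/
theorem potential_product_flat_connection
    (N : ℕ) (U : Set (Fin N → ℝ)) (hU : IsOpen U)
    (Φ : (Fin N → ℝ) → ℂ) (hΦ : ContDiffOn ℝ 4 Φ U)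
    (h : Matrix (Fin N) (Fin N) ℂ) (hh_inv : IsUnit h)
    (hh_symm : h.IsSymm)
    (pd : Fin N → ((Fin N → ℝ) → ℂ) → ((Fin N → ℝ) → ℂ))
    (hpd : ∀ ℓ f t, pd ℓ f t = fderiv ℝ f t (Pi.single ℓ 1))
    (Γ : Fin N → (Fin N → ℝ) → Matrix (Fin N) (Fin N) ℂ)
    (hΓ : ∀ ℓ t i j, Γ ℓ t i j = ∑ k, pd ℓ (pd j (pd k Φ)) t * h⁻¹ k i)
    (hcommute : ∀ t ∈ U, ∀ s ℓ : Fin N, Γ s t * Γ ℓ t = Γ ℓ t * Γ s t) :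
    (∀ t ∈ U, ∀ s ℓ : Fin N,
      fderiv ℝ (Γ ℓ) t (Pi.single s 1) = fderiv ℝ (Γ s) t (Pi.single ℓ 1)) ∧
    (∀ ℏ : ℂ, ∀ t ∈ U, ∀ s ℓ : Fin N,
      ℏ • (fderiv ℝ (Γ ℓ) t (Pi.single s 1) - fderiv ℝ (Γ s) t (Pi.single ℓ 1))
        + (ℏ ^ 2) • (Γ s t * Γ ℓ t - Γ ℓ t * Γ s t) = 0) := by
  have hpd' (ℓ f) : pd ℓ f = fun t => fderiv ℝ f t (Pi.single ℓ 1) := funext (hpd ℓ f)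
  have hsmooth {m n : WithTop ℕ∞} {f : (Fin N → ℝ) → ℂ} (hf : ContDiffOn ℝ n f U)
      (hmn : m + 1 ≤ n) (ℓ : Fin N) : ContDiffOn ℝ m (pd ℓ f) U := by
    rw [hpd']
    exact hf.fderiv_apply_const_of_isOpen hU hmn _
  have hsnd (j k : Fin N) : ContDiffOn ℝ 2 (pd j (pd k Φ)) U :=
    hsmooth (hsmooth (m := 3) hΦ (by norm_num) k) (by norm_num) j
  have hΓfun (ℓ i j) : (fun t => Γ ℓ t i j) =
      fun t => ∑ k, pd ℓ (pd j (pd k Φ)) t * h⁻¹ k i := funext fun t => hΓ ℓ t i j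
  have hsymm : ∀ t ∈ U, ∀ s ℓ : Fin N,
      fderiv ℝ (Γ ℓ) t (Pi.single s 1) = fderiv ℝ (Γ s) t (Pi.single ℓ 1) := by
    intro t ht s ℓ
    have hU_nhds := hU.mem_nhds ht
    have hthird (ℓ j k : Fin N) : DifferentiableAt ℝ (pd ℓ (pd j (pd k Φ))) t :=
      ((hsmooth (m := 1) (hsnd j k) (by norm_num) ℓ).contDiffAt hU_nhds).differentiableAt
        one_ne_zero
    have hentry (ℓ i j : Fin N) : HasFDerivAt (fun t => Γ ℓ t i j)
        (∑ k, h⁻¹ k i • fderiv ℝ (pd ℓ (pd j (pd k Φ))) t) t := by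
      rw [hΓfun]
      exact HasFDerivAt.fun_sum fun k _ => (hthird ℓ j k).hasFDerivAt.mul_const _
    have hdiff (ℓ i j : Fin N) := (hentry ℓ i j).differentiableAt
    ext i j
    rw [Matrix.fderiv_apply_apply (hdiff ℓ), Matrix.fderiv_apply_apply (hdiff s),
      (hentry ℓ i j).fderiv, (hentry s i j).fderiv]
    simp only [_root_.sum_apply, _root_.smul_apply]
    refine Finset.sum_congr rfl fun k _ => ?_
    rw [hpd' ℓ (pd j _), hpd' s (pd j _),
      ((hsnd j k).contDiffAt hU_nhds).fderiv_fderiv_apply_comm]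
  refine ⟨hsymm, fun ℏ t ht s ℓ => ?_⟩
  rw [hsymm t ht s ℓ, hcommute t ht s ℓ]
  simp
end

section
/- Let a, c ∈ ℂ and n ≥ 1. For j ≥ 0 let M_j ∈ M_2(ℂ) be the matrix M_j = [[a + c − j, c], [j+1, 0]]. Then Σ_{k=0}^{n} binom(a,k) · c^{n−k}/(n−k)! = (1/n!) · [M_{n−1} M_{n−2} ⋯ M_0]_{(1,1)}, where binom(a,k) = (∏_{i=0}^{k−1}(a − i))/k! is the generalized binomial coefficient and the factors are ordered with decreasing j from left to right. -/
open Finset in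
/-- Convolution form of the Leibniz rule: if `(k + 1) b (k + 1) = (a - k) b k` and
`(k + 1) e (k + 1) = c e k`, the convolution of `b` and `e` satisfies a first-order recurrence
with the first moment in `e` as remainder. -/
theorem succ_mul_sum_antidiagonal_succ {R : Type*} [CommRing R] {a c : R} {b e : ℕ → R}
    (hb : ∀ k : ℕ, ((k : R) + 1) * b (k + 1) = (a - k) * b k)
    (he : ∀ k : ℕ, ((k : R) + 1) * e (k + 1) = c * e k) (n : ℕ) :
    ((n : R) + 1) * ∑ p ∈ antidiagonal (n + 1), b p.1 * e p.2 =
      (a + c - n) * ∑ p ∈ antidiagonal n, b p.1 * e p.2 +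
        ∑ p ∈ antidiagonal n, (p.2 : R) * (b p.1 * e p.2) := by
  have split : ((n : R) + 1) * ∑ p ∈ antidiagonal (n + 1), b p.1 * e p.2 =
      ∑ p ∈ antidiagonal (n + 1), (p.1 : R) * b p.1 * e p.2 +
        ∑ p ∈ antidiagonal (n + 1), b p.1 * ((p.2 : R) * e p.2) := by
    rw [mul_sum, ← sum_add_distrib]
    refine sum_congr rfl fun p hp => ?_
    have h : (p.1 : R) + p.2 = n + 1 :=
      mod_cast congrArg (Nat.cast (R := R)) (mem_antidiagonal.1 hp)
    rw [← h]
    ring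
  rw [split, Nat.sum_antidiagonal_succ, Nat.sum_antidiagonal_succ']
  simp only [Nat.cast_zero, zero_mul, mul_zero, zero_add, Nat.cast_add, Nat.cast_one, hb, he]
  rw [mul_sum, ← sum_add_distrib, ← sum_add_distrib]
  refine sum_congr rfl fun p hp => ?_
  have h : (p.1 : R) + p.2 = n := mod_cast congrArg (Nat.cast (R := R)) (mem_antidiagonal.1 hp)
  rw [← h]
  ring

open Finset in
/-- The first moment in `e` of the convolution of `b` and `e`, if `(k + 1) e (k + 1) = c e k`. -/
theorem sum_antidiagonal_succ_snd_mul {R : Type*} [CommRing R] {c : R} {b e : ℕ → R}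
    (he : ∀ k : ℕ, ((k : R) + 1) * e (k + 1) = c * e k) (n : ℕ) :
    ∑ p ∈ antidiagonal (n + 1), (p.2 : R) * (b p.1 * e p.2) =
      c * ∑ p ∈ antidiagonal n, b p.1 * e p.2 := by
  simp only [mul_left_comm _ (b _)]
  rw [Nat.sum_antidiagonal_succ', mul_sum]
  simp only [Nat.cast_zero, zero_mul, mul_zero, zero_add, Nat.cast_add, Nat.cast_one, he]
  exact sum_congr rfl fun p _ => mul_left_comm _ _ _

open Finset in
/-- The first column of the product of the matrices `M j`, in terms of a convolution. -/
theorem prod_reverse_range_first_column {R : Type*} [CommRing R] {a c : R} {b e : ℕ → R}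
    (hb₀ : b 0 = 1) (he₀ : e 0 = 1)
    (hb : ∀ k : ℕ, ((k : R) + 1) * b (k + 1) = (a - k) * b k)
    (he : ∀ k : ℕ, ((k : R) + 1) * e (k + 1) = c * e k)
    {M : ℕ → Matrix (Fin 2) (Fin 2) R}
    (hM : ∀ j : ℕ, M j = !![a + c - (j : R), c; (j : R) + 1, 0]) (n : ℕ) :
    ((List.range n).reverse.map M).prod 0 0 =
        (n.factorial : R) * ∑ p ∈ antidiagonal n, b p.1 * e p.2 ∧
      c * ((List.range n).reverse.map M).prod 1 0 =
        (n.factorial : R) * ∑ p ∈ antidiagonal n, (p.2 : R) * (b p.1 * e p.2) := by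
  induction n with
  | zero => simp [hb₀, he₀]
  | succ n ih =>
    obtain ⟨h₀, h₁⟩ := ih
    rw [List.range_succ, List.reverse_append, List.reverse_singleton, List.singleton_append,
      List.map_cons, List.prod_cons, hM n, Matrix.mul_apply, Matrix.mul_apply,
      sum_antidiagonal_succ_snd_mul he, Nat.factorial_succ]
    have h := succ_mul_sum_antidiagonal_succ hb he n
    simp only [Fin.sum_univ_two, Matrix.of_apply, Matrix.cons_val', Matrix.cons_val_zero,
      Matrix.cons_val_one, Matrix.cons_val_fin_one, Nat.cast_mul, Nat.cast_add, Nat.cast_one]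
    constructor
    · linear_combination (a + c - n) * h₀ + h₁ - (n.factorial : R) * h
    · linear_combination c * ((n : R) + 1) * h₀

/-- **A "cute identity": generalized binomial convolution as a `2×2` matrix product.**
Let `a, c ∈ ℂ` and `n ≥ 1`, and for `j ≥ 0` set `M j = [[a + c − j, c], [j+1, 0]]`.
Then `Σ_{k=0}^n binom(a,k) c^{n−k}/(n−k)! = (1/n!) [M (n−1) ⋯ M 0]_{(1,1)}`, where
`binom(a,k) = (∏_{i=0}^{k−1} (a−i))/k!` is the generalized binomial coefficient and
the factors are ordered with decreasing `j` from left to right. -/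
theorem binomial_convolution_eq_matrix_product
    (a c : ℂ) (n : ℕ) (hn : 1 ≤ n)
    (M : ℕ → Matrix (Fin 2) (Fin 2) ℂ)
    (hM : ∀ j : ℕ, M j = !![a + c - (j : ℂ), c; (j : ℂ) + 1, 0]) :
    ∑ k ∈ Finset.range (n + 1),
        ((∏ i ∈ Finset.range k, (a - (i : ℂ))) / (Nat.factorial k : ℂ))
          * c ^ (n - k) / (Nat.factorial (n - k) : ℂ)
      = ((Nat.factorial n : ℂ))⁻¹ * ((((List.range n).reverse.map M).prod) 0 0) := by
  have hb (k : ℕ) : ((k : ℂ) + 1) *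
      ((∏ i ∈ Finset.range (k + 1), (a - (i : ℂ))) / ((k + 1).factorial : ℂ)) =
      (a - k) * ((∏ i ∈ Finset.range k, (a - (i : ℂ))) / (k.factorial : ℂ)) := by
    have h₁ : (k : ℂ) + 1 ≠ 0 := k.cast_add_one_ne_zero
    have h₂ : (k.factorial : ℂ) ≠ 0 := Nat.cast_ne_zero.2 k.factorial_ne_zero
    rw [Finset.prod_range_succ, Nat.factorial_succ]
    push_cast
    field_simp
  have he (k : ℕ) : ((k : ℂ) + 1) * (c ^ (k + 1) / ((k + 1).factorial : ℂ)) =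
      c * (c ^ k / (k.factorial : ℂ)) := by
    have h₁ : (k : ℂ) + 1 ≠ 0 := k.cast_add_one_ne_zero
    have h₂ : (k.factorial : ℂ) ≠ 0 := Nat.cast_ne_zero.2 k.factorial_ne_zero
    rw [Nat.factorial_succ, pow_succ']
    push_cast
    field_simp
  rw [(prod_reverse_range_first_column
      (b := fun k => (∏ i ∈ Finset.range k, (a - (i : ℂ))) / (k.factorial : ℂ))
      (e := fun k => c ^ k / (k.factorial : ℂ)) (by simp) (by simp) hb he hM n).1,
    inv_mul_cancel_left₀ (Nat.cast_ne_zero.2 n.factorial_ne_zero),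
    Finset.Nat.sum_antidiagonal_eq_sum_range_succ_mk]
  exact Finset.sum_congr rfl fun k _ => mul_div_assoc _ _ _
end

section
/- Let A, C ∈ M_d(ℂ). Define matrices B_{k,j} ∈ M_d(ℂ) for k ∈ ℤ, j ≥ 0 by: B_{k,j} = 0 for k < 0, B_{k,0} = δ_{k,0}·Id, and B_{k,j+1} = (1/(j+1)) [ (A − k·Id) B_{k,j} + C B_{k−1,j} ]. For k ≥ 0 let D_k be the (k+1)×(k+1) block matrix over M_d(ℂ) with diagonal blocks (D_k)_{p,p} = A − (k+1−p)·Id for p = 1, …, k+1 (so the diagonal reads A−k, A−k+1, …, A−1, A), superdiagonal blocks (D_k)_{p,p+1} = C, and all other blocks zero. Then for all k ≥ 0 and j ≥ 0, B_{k,j} = (1/j!) · [(D_k)^j]_{(1,k+1)}, the (1,k+1) block of (D_k)^j. -/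
/-- A block-bidiagonal row acts on a block column by its diagonal and its superdiagonal entry; the
superdiagonal contribution of the last row is dropped. -/
theorem sum_bidiagonal_mul {R : Type*} [NonUnitalNonAssocSemiring R] {k : ℕ} (p : Fin (k + 1))
    (a c : R) (f : ℕ → R) (hf : f (k + 1) = 0) :
    ∑ q : Fin (k + 1), (if q = p then a else if (q : ℕ) = (p : ℕ) + 1 then c else 0) * f q
      = a * f p + c * f (p + 1) := by
  have split_row : ∀ q : Fin (k + 1),
      (if q = p then a else if (q : ℕ) = (p : ℕ) + 1 then c else 0) * f q
        = (if q = p then a * f q else 0) + (if (q : ℕ) = (p : ℕ) + 1 then c * f q else 0) := by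
    intro q
    by_cases h : q = p
    · subst h; simp
    · simp [h, ite_mul]
  rw [Finset.sum_congr rfl fun q _ => split_row q, Finset.sum_add_distrib,
    Finset.sum_ite_eq' Finset.univ p, if_pos (Finset.mem_univ p),
    Fin.sum_univ_eq_sum_range (fun q => if q = (p : ℕ) + 1 then c * f q else 0),
    Finset.sum_ite_eq']
  congr 1
  split_ifs with h
  · rfl
  · have hp : (p : ℕ) + 1 = k + 1 := by
      have := p.isLt
      rw [Finset.mem_range] at h
      omega
    rw [hp, hf, mul_zero]


/-- **Substitution III: closed form for the coefficients `B_{k,j}`.**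
Let `A, C ∈ M_d(ℂ)` and define `B_{k,j}` for `k ∈ ℤ, j ≥ 0` by `B_{k,j} = 0` for `k < 0`,
`B_{k,0} = δ_{k,0}·Id`, and `B_{k,j+1} = (1/(j+1))[(A − k·Id)B_{k,j} + C·B_{k−1,j}]`.
For `k ≥ 0` let `D k` be the `(k+1)×(k+1)` block matrix with diagonal blocks
`A−k, A−k+1, …, A−1, A`, superdiagonal blocks `C`, other blocks `0`.  Then
`B_{k,j} = (1/j!) [(D k)^j]_{(1,k+1)}`. -/
theorem substitution_III_coefficients
    (d : ℕ) (A C : Matrix (Fin d) (Fin d) ℂ)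
    (B : ℤ → ℕ → Matrix (Fin d) (Fin d) ℂ)
    (hBneg : ∀ k : ℤ, k < 0 → ∀ j : ℕ, B k j = 0)
    (hB0 : ∀ k : ℤ, B k 0 = if k = 0 then 1 else 0)
    (hBrec : ∀ (k : ℤ) (j : ℕ),
      B k (j + 1) = (((j : ℂ) + 1)⁻¹) •
        ((A - (k : ℂ) • 1) * B k j + C * B (k - 1) j))
    (D : (k : ℕ) → Matrix (Fin (k + 1)) (Fin (k + 1)) (Matrix (Fin d) (Fin d) ℂ))
    (hD : ∀ (k : ℕ) (p q : Fin (k + 1)),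
      D k p q =
        if q = p then A - (((k : ℂ) - (p : ℕ)) • 1)
        else if (q : ℕ) = (p : ℕ) + 1 then C
        else 0) :
    ∀ (k j : ℕ),
      B (k : ℤ) j = ((Nat.factorial j : ℂ))⁻¹ • ((D k ^ j) 0 (Fin.last k)) := by
  intro k j
  have last_column : ∀ (j : ℕ) (p : Fin (k + 1)),
      (D k ^ j) p (Fin.last k) = (Nat.factorial j : ℂ) • B ((k : ℤ) - (p : ℕ)) j := by
    intro j
    induction j with
    | zero =>
      intro p
      have hp : ((k : ℤ) - (p : ℕ) = 0) ↔ p = Fin.last k := by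
        rw [Fin.ext_iff, Fin.val_last]
        omega
      simp only [pow_zero, Matrix.one_apply, hB0, hp, Nat.factorial_zero, Nat.cast_one, one_smul]
    | succ j ih =>
      intro p
      rw [pow_succ', Matrix.mul_apply]
      simp only [ih, hD]
      rw [sum_bidiagonal_mul p _ _
          (fun q => (Nat.factorial j : ℂ) • B ((k : ℤ) - (q : ℕ)) j)
          (by rw [hBneg _ (by push_cast; omega), smul_zero]),
        hBrec, smul_smul, Nat.factorial_succ]
      have hscal : (((j + 1) * Nat.factorial j : ℕ) : ℂ) * ((j : ℂ) + 1)⁻¹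
          = (Nat.factorial j : ℂ) := by
        push_cast
        field_simp
      have hidx : (k : ℤ) - ((p : ℕ) + 1 : ℕ) = (k : ℤ) - (p : ℕ) - 1 := by
        push_cast
        ring
      rw [hscal, hidx, smul_add, mul_smul_comm, mul_smul_comm]
      push_cast
      rfl
  rw [last_column j 0, smul_smul, inv_mul_cancel₀ (Nat.cast_ne_zero.mpr j.factorial_ne_zero),
    one_smul]
  simp
end
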